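/- arXiv:2203.12189 — 7 statements merged into one kernel-verified Lean document; each statement's English description precedes it below -/
import Mathlib

section
/- Consider the DW model on a hypergraph H = (V, E) with N = |V| nodes, confidence bound c > 0, hyperedge selection probabilities p_e ≥ 0 with Σ_{e∈E} p_e = 1, and DW update maps T_e. Let μ be a probability measure on ℝ^V whose one-point marginals (proj_i)_# μ are all equal to a common probability measure G on ℝ, and assume the independence condition: for every hyperedge e ∈ E, the marginal of μ on the coordinates indexed by e equals the product measure G^{⊗|e|}. Let μ' = Σ_{e∈E} p_e (T_e)_# μ be the law after one DW update step, and let G' = (1/N) Σ_{i∈V} (proj_i)_# μ' be the averaged one-point marginal of μ'. Then for every bounded measurable φ : ℝ → ℝ, ∫ φ dG' − ∫ φ dG = (1/N) Σ_{e∈E} p_e ∫_{ℝ^{|e|}} 1{d_p(y) < c} [ |e| φ(ȳ) − Σ_{i=1}^{|e|} φ(y_i) ] dG^{⊗|e|}(y), where ȳ = (1/|e|) Σ_{i=1}^{|e|} y_i. -/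
open MeasureTheory
open scoped ENNReal

/-- The discordance `d_p` of a vector `y ∈ ℝ^ι`:
`d_p(y) = α_p * ((1/m) Σ_i |y_i - ȳ|^p)^(1/p)` where `ȳ = (1/m) Σ_i y_i` and `m = |ι|`. -/
noncomputable def disc {ι : Type*} [Fintype ι] (p αp : ℝ) (y : ι → ℝ) : ℝ :=
  αp * ((1 / (Fintype.card ι : ℝ)) *
    ∑ i, |y i - (1 / (Fintype.card ι : ℝ)) * ∑ j, y j| ^ p) ^ (1 / p)

/-- The Deffuant--Weisbuch update map `T_e : ℝ^V → ℝ^V` associated with a hyperedge `e ⊆ V`. -/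
noncomputable def dwUpdate {V : Type*} [Fintype V] [DecidableEq V]
    (p αp c : ℝ) (e : Finset V) (x : V → ℝ) : V → ℝ :=
  if disc p αp (fun i : e => x i.1) < c then
    fun i => if i ∈ e then (1 / (e.card : ℝ)) * ∑ j ∈ e, x j else x i
  else x

theorem measurable_disc_aux {ι : Type*} [Fintype ι] (p αp : ℝ) :
    Measurable (fun y : ι → ℝ => disc p αp y) := by
  unfold disc
  refine Measurable.const_mul (Measurable.pow_const (Measurable.const_mul ?_ _) _) _
  refine Finset.measurable_sum _ fun i _ => Measurable.pow_const ?_ _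
  have h : Measurable (fun y : ι → ℝ => y i - (1 / (Fintype.card ι : ℝ)) * ∑ j, y j) := by
    fun_prop
  exact continuous_abs.measurable.comp h

theorem measurable_dwUpdate_aux {V : Type*} [Fintype V] [DecidableEq V]
    (p αp c : ℝ) (e : Finset V) : Measurable (dwUpdate p αp c e) := by
  have hr : Measurable (fun (x : V → ℝ) (i : e) => x i.1) := by fun_prop
  refine Measurable.ite (measurableSet_lt ((measurable_disc_aux p αp).comp hr) measurable_const)
    ?_ measurable_id
  refine measurable_pi_lambda _ fun i => ?_
  by_cases hi : i ∈ e
  · simp only [hi, if_true]; fun_prop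
  · simp only [hi, if_false]; fun_prop

theorem pointwise_aux {V : Type*} [Fintype V] [DecidableEq V]
    (p αp c : ℝ) (e : Finset V) (φ : ℝ → ℝ) (x : V → ℝ) :
    ∑ i, (φ (dwUpdate p αp c e x i) - φ (x i)) =
      if disc p αp (fun i : e => x i.1) < c then
        (e.card : ℝ) * φ ((1 / (e.card : ℝ)) * ∑ i : e, x i.1) - ∑ i : e, φ (x i.1)
      else 0 := by
  unfold dwUpdate
  split_ifs with h
  · rw [Finset.sum_coe_sort e (fun i => x i), Finset.sum_coe_sort e (fun i => φ (x i)),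
      ← Finset.sum_subset (Finset.subset_univ e)]
    · rw [Finset.sum_sub_distrib]
      congr 1
      rw [Finset.sum_congr rfl (g := fun _ => φ ((1 / (e.card : ℝ)) * ∑ i ∈ e, x i))]
      · simp
      · intro i hi; simp [hi]
    · intro i _ hi; simp [hi]
  · simp

/-- the one-point density equation for a DW step under the independence
(mean-field) assumption. If all one-point marginals of `μ` equal `G` and, for every
hyperedge `e`, the marginal of `μ` on the coordinates of `e` is the product `G^{⊗|e|}`,
then the averaged one-point marginal `G'` of `μ' = Σ_e p_e (T_e)_# μ` satisfies, for every
bounded measurable `φ : ℝ → ℝ`,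
`∫ φ dG' − ∫ φ dG = (1/N) Σ_e p_e ∫ 1{d_p(y) < c} [|e| φ(ȳ) − Σ_i φ(y_i)] dG^{⊗|e|}(y)`. -/
theorem dw_one_point_density {V : Type*} [Fintype V] [DecidableEq V] [Nonempty V]
    (p αp c : ℝ) (hp : 0 < p) (hαp : 0 < αp) (hc : 0 < c)
    (E : Finset (Finset V)) (hE : ∀ e ∈ E, 2 ≤ e.card)
    (pE : Finset V → ℝ) (hpE : ∀ e ∈ E, 0 ≤ pE e) (hsum : ∑ e ∈ E, pE e = 1)
    (μ : Measure (V → ℝ)) (hμ : IsProbabilityMeasure μ)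
    (G : Measure ℝ) (hG : IsProbabilityMeasure G)
    (hmarg : ∀ i : V, μ.map (fun x => x i) = G)
    (hindep : ∀ e ∈ E, μ.map (fun x (i : e) => x i.1) = Measure.pi (fun _ : e => G))
    (μ' : Measure (V → ℝ))
    (hμ' : μ' = ∑ e ∈ E, ENNReal.ofReal (pE e) • μ.map (dwUpdate p αp c e))
    (G' : Measure ℝ)
    (hG' : G' = ((Fintype.card V : ℝ≥0∞))⁻¹ • ∑ i : V, μ'.map (fun x => x i)) :
    ∀ φ : ℝ → ℝ, Measurable φ → (∃ C, ∀ x, |φ x| ≤ C) →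
      (∫ a, φ a ∂G') - ∫ a, φ a ∂G =
        (1 / (Fintype.card V : ℝ)) * ∑ e ∈ E, pE e *
          ∫ y : e → ℝ,
            (if disc p αp y < c then
              (e.card : ℝ) * φ ((1 / (e.card : ℝ)) * ∑ i : e, y i) - ∑ i : e, φ (y i)
             else 0) ∂(Measure.pi fun _ : e => G) := by
  intro φ hφ hb
  obtain ⟨C, hC⟩ := hb
  have hT := fun e => measurable_dwUpdate_aux (V := V) p αp c e
  have hint' : ∀ (ν : Measure ℝ), IsFiniteMeasure ν → Integrable φ ν := by
    intro ν hν
    exact Integrable.of_bound hφ.aestronglyMeasurable C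
      (Filter.Eventually.of_forall fun a => hC _)
  have hN : (Fintype.card V : ℝ) ≠ 0 := by exact_mod_cast Fintype.card_ne_zero
  have hi' : ∀ i : V, ∫ a, φ a ∂(μ'.map (fun x => x i)) =
      ∑ e ∈ E, pE e * ∫ x, φ (dwUpdate p αp c e x i) ∂μ := by
    intro i
    have hev : Measurable (fun x : V → ℝ => x i) := measurable_pi_apply i
    rw [integral_map hev.aemeasurable hφ.aestronglyMeasurable, hμ', integral_finsetSum_measure]
    · refine Finset.sum_congr rfl fun e he => ?_
      rw [integral_smul_measure, ENNReal.toReal_ofReal (hpE e he), smul_eq_mul]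
      exact congrArg (pE e * ·)
        (integral_map (hT e).aemeasurable (hφ.comp hev).aestronglyMeasurable)
    · intro e he
      refine Integrable.smul_measure ?_ ENNReal.ofReal_ne_top
      exact Integrable.of_bound (hφ.comp hev).aestronglyMeasurable C
        (Filter.Eventually.of_forall fun a => hC _)
  have hfin : IsFiniteMeasure μ' := by
    rw [hμ']
    have : ∀ e ∈ E, (ENNReal.ofReal (pE e) • μ.map (dwUpdate p αp c e)) Set.univ < ⊤ := by
      intro e he
      rw [Measure.smul_apply, smul_eq_mul]
      exact ENNReal.mul_lt_top ENNReal.ofReal_lt_top (measure_lt_top _ _)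
    refine ⟨?_⟩
    rw [Measure.finsetSum_apply]
    exact ENNReal.sum_lt_top.2 this
  have h1 : ∫ a, φ a ∂G' = (1 / (Fintype.card V : ℝ)) *
      ∑ e ∈ E, pE e * ∑ i, ∫ x, φ (dwUpdate p αp c e x i) ∂μ := by
    rw [hG', integral_smul_measure, integral_finsetSum_measure]
    · simp only [hi', Finset.mul_sum, smul_eq_mul, ENNReal.toReal_inv, ENNReal.toReal_natCast,
        one_div]
      rw [Finset.sum_comm]
    · intro i _
      exact hint' _ inferInstance
  have h2 : ∫ a, φ a ∂G = (1 / (Fintype.card V : ℝ)) *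
      ∑ e ∈ E, pE e * ∑ i : V, ∫ x, φ (x i) ∂μ := by
    have : ∀ i : V, ∫ x, φ (x i) ∂μ = ∫ a, φ a ∂G := by
      intro i
      rw [← hmarg i, integral_map (measurable_pi_apply i).aemeasurable hφ.aestronglyMeasurable]
    simp only [this]
    rw [← Finset.sum_mul, hsum]
    simp [hN]
  rw [h1, h2, ← mul_sub, ← Finset.sum_sub_distrib]
  congr 1
  refine Finset.sum_congr rfl fun e he => ?_
  rw [← mul_sub, ← Finset.sum_sub_distrib]
  congr 1
  have hr : Measurable (fun (x : V → ℝ) (i : e) => x i.1) := by fun_prop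
  have hA : ∀ i : V, Integrable (fun x => φ (dwUpdate p αp c e x i)) μ := fun i =>
    Integrable.of_bound (hφ.comp ((measurable_pi_apply i).comp (hT e))).aestronglyMeasurable C
      (Filter.Eventually.of_forall fun a => hC _)
  have hB : ∀ i : V, Integrable (fun x : V → ℝ => φ (x i)) μ := fun i =>
    Integrable.of_bound (hφ.comp (measurable_pi_apply i)).aestronglyMeasurable C
      (Filter.Eventually.of_forall fun a => hC _)
  rw [← hindep e he, integral_map hr.aemeasurable]
  · simp only [← pointwise_aux p αp c e φ]
    refine Eq.trans ?_ (integral_finsetSum _ (fun i _ => (hA i).sub (hB i))).symm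
    exact Finset.sum_congr rfl fun i _ => (integral_sub (hA i) (hB i)).symm
  · refine Measurable.aestronglyMeasurable ?_
    refine Measurable.ite (measurableSet_lt (measurable_disc_aux p αp) measurable_const)
      ?_ measurable_const
    refine Measurable.sub (Measurable.const_mul (hφ.comp (by fun_prop)) _) ?_
    exact Finset.measurable_sum _ fun i _ => hφ.comp (measurable_pi_apply i)
end

section
/- Let φ : ℝ → ℝ be a convex function and let g : ℝ × [0,∞) → [0,∞) be a nonnegative function satisfying the weak-form rate equation for φ. Then the expectation t ↦ ∫_ℝ φ(a) g(a, t) da is nonincreasing in t. -/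
open MeasureTheory

/-- The right-hand side of the weak-form rate equation for an observable `φ`:
`Σ_e m_e p_e ∫_{ℝ^{m_e}} 1{d_p(y) < c} (Π_i g(y_i,t)) [φ(ȳ) − (1/m_e) Σ_i φ(y_i)] dy`,
where `ȳ = (1/m_e) Σ_i y_i`. -/
noncomputable def weakRHS {ι : Type*} [Fintype ι] (msize : ι → ℕ) (pE : ι → ℝ)
    (p αp c : ℝ) (g : ℝ → ℝ → ℝ) (φ : ℝ → ℝ) (t : ℝ) : ℝ :=
  ∑ e : ι, (msize e : ℝ) * pE e *
    ∫ y : Fin (msize e) → ℝ,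
      (if disc p αp y < c then
        (∏ i, g (y i) t) *
          (φ ((1 / (msize e : ℝ)) * ∑ i, y i) - (1 / (msize e : ℝ)) * ∑ i, φ (y i))
       else 0)

/-- if `φ` is convex and the nonnegative density `g` satisfies the weak-form
rate equation for `φ`, then the expectation `t ↦ ∫ φ(a) g(a,t) da` is nonincreasing in `t`
(on `t ≥ 0`). -/
theorem expectation_convex_nonincreasing {ι : Type*} [Fintype ι]
    (msize : ι → ℕ) (hm : ∀ e, 2 ≤ msize e)
    (pE : ι → ℝ) (hpE : ∀ e, 0 ≤ pE e) (hsum : ∑ e, pE e = 1)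
    (p αp c : ℝ) (hp : 0 < p) (hαp : 0 < αp) (hc : 0 < c)
    (g : ℝ → ℝ → ℝ) (hpos : ∀ a t, 0 ≤ g a t)
    (φ : ℝ → ℝ) (hφ : ConvexOn ℝ Set.univ φ)
    (hfin : ∀ t : ℝ, 0 ≤ t → Integrable (fun a => φ a * g a t))
    (heq : ∀ t : ℝ, 0 ≤ t →
      HasDerivAt (fun s => ∫ a, φ a * g a s) (weakRHS msize pE p αp c g φ t) t) :
    AntitoneOn (fun t => ∫ a, φ a * g a t) (Set.Ici (0:ℝ)) := by
  have hle : ∀ t, weakRHS msize pE p αp c g φ t ≤ 0 := by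
    intro t
    unfold weakRHS
    refine Finset.sum_nonpos fun e _ => ?_
    have hme : (0 : ℝ) < (msize e : ℝ) := by
      have := hm e
      exact_mod_cast (by omega : 0 < msize e)
    refine mul_nonpos_of_nonneg_of_nonpos (mul_nonneg hme.le (hpE e)) ?_
    refine integral_nonpos fun y => ?_
    show (if _ then _ else _) ≤ (0 : ℝ)
    split_ifs
    · refine mul_nonpos_of_nonneg_of_nonpos (Finset.prod_nonneg fun i _ => hpos _ _) ?_
      have h := hφ.map_sum_le (t := Finset.univ) (w := fun _ : Fin (msize e) => 1 / (msize e : ℝ))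
        (p := y) (fun _ _ => by positivity) (by simp [hme.ne']) (fun _ _ => Set.mem_univ _)
      simp only [smul_eq_mul, ← Finset.mul_sum] at h
      linarith
    · exact le_rfl
  refine antitoneOn_of_hasDerivWithinAt_nonpos (convex_Ici 0)
    (fun t ht => (heq t ht).continuousAt.continuousWithinAt)
    (fun t ht => (heq t (interior_subset ht)).hasDerivWithinAt) (fun t _ => hle t)
end

section
/- Let k ≥ 2 be an even integer and let g : ℝ × [0,∞) → [0,∞) be a nonnegative function satisfying the weak-form rate equation for φ(a) = a^k. Then the k-th uncentered moment M_k(t) = ∫_ℝ a^k g(a, t) da is nonincreasing in t. -/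
open MeasureTheory

/-- if `k ≥ 2` is even and the nonnegative density `g` satisfies the
weak-form rate equation for `φ(a) = a^k`, then the `k`-th uncentered moment
`M_k(t) = ∫ a^k g(a,t) da` is nonincreasing in `t` (on `t ≥ 0`). -/
theorem even_moment_nonincreasing {ι : Type*} [Fintype ι]
    (msize : ι → ℕ) (hm : ∀ e, 2 ≤ msize e)
    (pE : ι → ℝ) (hpE : ∀ e, 0 ≤ pE e) (hsum : ∑ e, pE e = 1)
    (p αp c : ℝ) (hp : 0 < p) (hαp : 0 < αp) (hc : 0 < c)
    (g : ℝ → ℝ → ℝ) (hpos : ∀ a t, 0 ≤ g a t)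
    (k : ℕ) (hk : 2 ≤ k) (hkeven : Even k)
    (hfin : ∀ t : ℝ, 0 ≤ t → Integrable (fun a => a ^ k * g a t))
    (heq : ∀ t : ℝ, 0 ≤ t →
      HasDerivAt (fun s => ∫ a, a ^ k * g a s)
        (weakRHS msize pE p αp c g (fun a => a ^ k) t) t) :
    AntitoneOn (fun t => ∫ a, a ^ k * g a t) (Set.Ici (0:ℝ)) := by
  have hR : ∀ t, weakRHS msize pE p αp c g (fun a => a ^ k) t ≤ 0 := by
    intro t
    unfold weakRHS
    refine Finset.sum_nonpos fun e _ => ?_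
    refine mul_nonpos_of_nonneg_of_nonpos (mul_nonneg (Nat.cast_nonneg _) (hpE e)) ?_
    refine integral_nonpos fun y => ?_
    show (if disc p αp y < c then _ else (0 : ℝ)) ≤ 0
    split_ifs with h
    · refine mul_nonpos_of_nonneg_of_nonpos
        (Finset.prod_nonneg fun i _ => hpos _ _) (sub_nonpos.2 ?_)
      have hm0 : (msize e : ℝ) ≠ 0 := by
        have := hm e
        exact_mod_cast (by omega : msize e ≠ 0)
      have hJ := Real.pow_arith_mean_le_arith_mean_pow_of_even Finset.univ
        (fun _ : Fin (msize e) => 1 / (msize e : ℝ)) y (fun _ _ => by positivity)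
        (by simp [hm0]) hkeven
      simpa only [Finset.mul_sum] using hJ
    · exact le_rfl
  refine antitoneOn_of_deriv_nonpos (convex_Ici 0)
    (fun t ht => (heq t ht).continuousAt.continuousWithinAt) ?_ ?_
  · intro t ht
    exact (heq t (interior_subset ht)).differentiableAt.differentiableWithinAt
  · intro t ht
    rw [(heq t (interior_subset ht)).deriv]
    exact hR t
end

section
/- Let g : ℝ × [0,∞) → [0,∞) be a nonnegative function, let μ ∈ ℝ, and suppose g satisfies the weak-form rate equation for the observable φ(a) = (a − μ)². Then the variance V(t) = ∫_ℝ (a − μ)² g(a, t) da satisfies dV/dt(t) = −Σ_{e∈E} (p_e/(2 m_e)) ∫_{ℝ^{m_e}} 1{d_p(y) < c} (Π_{i=1}^{m_e} g(y_i, t)) Σ_{i=1}^{m_e} Σ_{j=1}^{m_e} (y_i − y_j)² dy for all t ≥ 0; in particular, dV/dt(t) ≤ 0 and V is nonincreasing. -/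
open MeasureTheory

/-- `φ(ȳ) − (1/m) Σ φ(y_i) = −(1/(2m²)) ΣΣ (y_i − y_j)²` for `φ(a) = (a − μ)²`. -/
lemma variance_identity (m : ℕ) (hm : (m : ℝ) ≠ 0) (y : Fin m → ℝ) (μ : ℝ) :
    ((1 / (m : ℝ)) * ∑ i, y i - μ) ^ 2 - (1 / (m : ℝ)) * ∑ i, (y i - μ) ^ 2
      = -(1 / (2 * (m : ℝ) ^ 2)) * ∑ i, ∑ j, (y i - y j) ^ 2 := by
  have h1 : ∑ i, (y i - μ) ^ 2 = ∑ i, y i ^ 2 - 2 * μ * ∑ i, y i + m * μ ^ 2 := by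
    simp only [sub_sq, Finset.sum_add_distrib, Finset.sum_sub_distrib, Finset.mul_sum]
    simp
    exact Finset.sum_congr rfl fun i _ => by ring
  have h2 : ∑ i, ∑ j, (y i - y j) ^ 2 = 2 * m * ∑ i, y i ^ 2 - 2 * (∑ i, y i) ^ 2 := by
    simp only [sub_sq, Finset.sum_add_distrib, Finset.sum_sub_distrib, ← Finset.mul_sum,
      ← Finset.sum_mul]
    simp [← Finset.mul_sum]
    ring
  rw [h1, h2]
  field_simp
  ring

/-- if the nonnegative density `g` satisfies the weak-form rate equation for
`φ(a) = (a − μ)²`, then the variance `V(t) = ∫ (a − μ)² g(a,t) da` satisfies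
`dV/dt(t) = −Σ_e (p_e/(2 m_e)) ∫ 1{d_p(y) < c} (Π_i g(y_i,t)) Σ_i Σ_j (y_i − y_j)² dy ≤ 0`
for all `t ≥ 0`, and `V` is nonincreasing on `t ≥ 0`. -/
theorem variance_derivative {ι : Type*} [Fintype ι]
    (msize : ι → ℕ) (hm : ∀ e, 2 ≤ msize e)
    (pE : ι → ℝ) (hpE : ∀ e, 0 ≤ pE e) (hsum : ∑ e, pE e = 1)
    (p αp c : ℝ) (hp : 0 < p) (hαp : 0 < αp) (hc : 0 < c)
    (g : ℝ → ℝ → ℝ) (hpos : ∀ a t, 0 ≤ g a t) (μ : ℝ)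
    (hfin : ∀ t : ℝ, 0 ≤ t → Integrable (fun a => (a - μ) ^ 2 * g a t))
    (heq : ∀ t : ℝ, 0 ≤ t →
      HasDerivAt (fun s => ∫ a, (a - μ) ^ 2 * g a s)
        (weakRHS msize pE p αp c g (fun a => (a - μ) ^ 2) t) t) :
    (∀ t : ℝ, 0 ≤ t →
      HasDerivAt (fun s => ∫ a, (a - μ) ^ 2 * g a s)
        (-∑ e : ι, pE e / (2 * (msize e : ℝ)) *
          ∫ y : Fin (msize e) → ℝ,
            (if disc p αp y < c then
              (∏ i, g (y i) t) * ∑ i, ∑ j, (y i - y j) ^ 2 else 0)) t ∧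
      -∑ e : ι, pE e / (2 * (msize e : ℝ)) *
          (∫ y : Fin (msize e) → ℝ,
            (if disc p αp y < c then
              (∏ i, g (y i) t) * ∑ i, ∑ j, (y i - y j) ^ 2 else 0)) ≤ 0) ∧
    AntitoneOn (fun t => ∫ a, (a - μ) ^ 2 * g a t) (Set.Ici (0:ℝ)) := by
  have key : ∀ t : ℝ, weakRHS msize pE p αp c g (fun a => (a - μ) ^ 2) t =
      -∑ e : ι, pE e / (2 * (msize e : ℝ)) *
          ∫ y : Fin (msize e) → ℝ,
            (if disc p αp y < c then
              (∏ i, g (y i) t) * ∑ i, ∑ j, (y i - y j) ^ 2 else 0) := by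
    intro t
    unfold weakRHS
    rw [← Finset.sum_neg_distrib]
    refine Finset.sum_congr rfl fun e _ => ?_
    have hm0 : (msize e : ℝ) ≠ 0 := by
      have := hm e
      exact_mod_cast (by omega : msize e ≠ 0)
    have h1 : ∀ y : Fin (msize e) → ℝ,
        (if disc p αp y < c then
          (∏ i, g (y i) t) *
            (((1 / (msize e : ℝ)) * ∑ i, y i - μ) ^ 2
              - (1 / (msize e : ℝ)) * ∑ i, (y i - μ) ^ 2)
         else 0) =
        (-(1 / (2 * (msize e : ℝ) ^ 2))) *
          (if disc p αp y < c then
              (∏ i, g (y i) t) * ∑ i, ∑ j, (y i - y j) ^ 2 else 0) := by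
      intro y
      split_ifs
      · rw [variance_identity (msize e) hm0 y μ]
        ring
      · simp
    simp only [h1]
    rw [integral_const_mul]
    field_simp
  have nonpos : ∀ t : ℝ, -∑ e : ι, pE e / (2 * (msize e : ℝ)) *
          (∫ y : Fin (msize e) → ℝ,
            (if disc p αp y < c then
              (∏ i, g (y i) t) * ∑ i, ∑ j, (y i - y j) ^ 2 else 0)) ≤ 0 := by
    intro t
    rw [neg_nonpos]
    refine Finset.sum_nonneg fun e _ => mul_nonneg
      (div_nonneg (hpE e) (by positivity)) (integral_nonneg fun y => ?_)
    show (0 : ℝ) ≤ if disc p αp y < c then _ else _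
    split_ifs
    · exact mul_nonneg (Finset.prod_nonneg fun i _ => hpos _ _)
        (Finset.sum_nonneg fun i _ => Finset.sum_nonneg fun j _ => sq_nonneg _)
    · exact le_rfl
  refine ⟨fun t ht => ⟨key t ▸ heq t ht, nonpos t⟩, ?_⟩
  refine antitoneOn_of_deriv_nonpos (convex_Ici 0)
    (fun t ht => (heq t ht).continuousAt.continuousWithinAt) ?_ ?_
  · intro t ht
    exact (heq t (interior_subset ht)).differentiableAt.differentiableWithinAt
  · intro t ht
    rw [(heq t (interior_subset ht)).deriv, key t]
    exact nonpos t
end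

section
/- Let m ≥ 2 be an integer, p > 0, α_p > 0, c > 0, and let d_p be the discordance on ℝ^m. Let g : ℝ → [0,∞) be Lebesgue measurable and suppose ∫_{ℝ^m} 1{d_p(y) < c} (Π_{i=1}^m g(y_i)) Σ_{i=1}^m Σ_{j=1}^m (y_i − y_j)² dy = 0. Then the set {a ∈ ℝ : g(a) > 0} has Lebesgue measure zero. -/
open MeasureTheory

theorem disc_measurable (m : ℕ) (p αp : ℝ) :
    Measurable (fun y : Fin m → ℝ => disc p αp y) := by
  unfold disc
  fun_prop

theorem disc_le (m : ℕ) (hm : 2 ≤ m) (p αp : ℝ) (hp : 0 < p) (hαp : 0 < αp)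
    (x r : ℝ) (hr : 0 < r) (y : Fin m → ℝ) (hy : ∀ i, |y i - x| ≤ r) :
    disc p αp y ≤ αp * (2 * r) := by
  have hm0 : (0 : ℝ) < m := by
    have : 0 < m := by omega
    exact_mod_cast this
  have h1 : ∑ j, y j ≤ m * (x + r) := by
    have := Finset.sum_le_card_nsmul Finset.univ y (x + r)
      (fun i _ => by have := abs_le.1 (hy i); linarith [this.2])
    rw [nsmul_eq_mul] at this
    simpa only [Finset.card_univ, Fintype.card_fin] using this
  have h2 : m * (x - r) ≤ ∑ j, y j := by
    have := Finset.card_nsmul_le_sum Finset.univ y (x - r)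
      (fun i _ => by have := abs_le.1 (hy i); linarith [this.1])
    rw [nsmul_eq_mul] at this
    simpa only [Finset.card_univ, Fintype.card_fin] using this
  have h3 : (1 / (m : ℝ)) * ∑ j, y j ≤ x + r := by
    rw [one_div, inv_mul_le_iff₀ hm0]; exact h1
  have h4 : x - r ≤ (1 / (m : ℝ)) * ∑ j, y j := by
    rw [one_div, le_inv_mul_iff₀ hm0]; exact h2
  unfold disc
  simp only [Fintype.card_fin]
  apply mul_le_mul_of_nonneg_left _ hαp.le
  have h5 : ∑ i, |y i - (1 / (m : ℝ)) * ∑ j, y j| ^ p ≤ m * (2 * r) ^ p := by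
    have := Finset.sum_le_card_nsmul Finset.univ
      (fun i => |y i - (1 / (m : ℝ)) * ∑ j, y j| ^ p) ((2 * r) ^ p)
      (fun i _ => by
        apply Real.rpow_le_rpow (abs_nonneg _) _ hp.le
        have := abs_le.1 (hy i)
        rw [abs_le]; constructor <;> linarith [this.1, this.2])
    simpa using this
  have h6 : (1 / (m : ℝ)) * ∑ i, |y i - (1 / (m : ℝ)) * ∑ j, y j| ^ p ≤ (2 * r) ^ p := by
    rw [one_div, inv_mul_le_iff₀ hm0]; simpa using h5
  calc _ ≤ ((2 * r) ^ p) ^ (1 / p) := by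
        apply Real.rpow_le_rpow _ h6 (by positivity)
        positivity
    _ = 2 * r := by
        rw [one_div, Real.rpow_rpow_inv (by positivity) hp.ne']

theorem diag_null (m : ℕ) (i j : Fin m) (hij : i ≠ j) :
    volume {y : Fin m → ℝ | y i = y j} = 0 := by
  let L : (Fin m → ℝ) →ₗ[ℝ] ℝ := (LinearMap.proj i : (Fin m → ℝ) →ₗ[ℝ] ℝ) - LinearMap.proj j
  have h : {y : Fin m → ℝ | y i = y j} = (LinearMap.ker L : Set (Fin m → ℝ)) := by
    ext y
    simp [L, sub_eq_zero]
  rw [h]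
  apply Measure.addHaar_submodule
  intro ht
  have : (Pi.single i 1 : Fin m → ℝ) ∈ LinearMap.ker L := by rw [ht]; trivial
  simp [L, Pi.single_apply, hij.symm] at this

/-- if `g : ℝ → [0,∞)` is Lebesgue measurable and the interaction
functional `∫_{ℝ^m} 1{d_p(y) < c} (Π_i g(y_i)) Σ_i Σ_j (y_i − y_j)² dy` vanishes, then
the set `{a : g(a) > 0}` has Lebesgue measure zero. -/
theorem steady_state_null_support (m : ℕ) (hm : 2 ≤ m)
    (p αp c : ℝ) (hp : 0 < p) (hαp : 0 < αp) (hc : 0 < c)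
    (g : ℝ → ℝ) (hmeas : Measurable g) (hg : ∀ a, 0 ≤ g a)
    (hzero : ∫⁻ y : Fin m → ℝ,
        (if disc p αp y < c then
          ENNReal.ofReal ((∏ i, g (y i)) * ∑ i, ∑ j, (y i - y j) ^ 2) else 0) = 0) :
    volume {a : ℝ | 0 < g a} = 0 := by
  by_contra hS
  obtain ⟨x, -, hx⟩ := exists_mem_forall_mem_nhdsWithin_pos_measure hS
  have hr : 0 < c / (4 * αp) := by positivity
  set r := c / (4 * αp) with hrdef
  have hT := hx _ (inter_mem_nhdsWithin _ (Metric.closedBall_mem_nhds x hr))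
  set T := {a : ℝ | 0 < g a} ∩ Metric.closedBall x r with hTdef
  have hbox : volume (Set.univ.pi (fun _ : Fin m => T)) ≠ 0 := by
    rw [volume_pi_pi]
    exact Finset.prod_ne_zero_iff.2 (fun _ _ => hT.ne')
  rw [lintegral_eq_zero_iff] at hzero
  · apply hbox
    let i : Fin m := ⟨0, by omega⟩
    let j : Fin m := ⟨1, by omega⟩
    have hij : i ≠ j := by simp [i, j]
    have hd := diag_null m i j hij
    refine measure_mono_null ?_ (measure_union_null hd (ae_iff.1 hzero))
    intro y hy
    by_cases he : y i = y j
    · exact Or.inl he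
    right
    have hyT : ∀ k, y k ∈ T := fun k => hy k trivial
    have hdisc : disc p αp y < c := by
      refine lt_of_le_of_lt (disc_le m hm p αp hp hαp x r hr y
        (fun k => by simpa [Real.dist_eq] using (hyT k).2)) ?_
      have : αp * (2 * r) = c / 2 := by rw [hrdef]; field_simp; norm_num
      linarith
    have hprod : 0 < ∏ k, g (y k) := Finset.prod_pos (fun k _ => (hyT k).1)
    have hsum : 0 < ∑ a, ∑ b, (y a - y b) ^ 2 := by
      have h1 : 0 < (y i - y j) ^ 2 := by
        have := sub_ne_zero.2 he
        positivity
      have h2 : (y i - y j) ^ 2 ≤ ∑ b, (y i - y b) ^ 2 :=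
        Finset.single_le_sum (f := fun b => (y i - y b) ^ 2)
          (fun b _ => sq_nonneg _) (Finset.mem_univ j)
      have h3 : ∑ b, (y i - y b) ^ 2 ≤ ∑ a, ∑ b, (y a - y b) ^ 2 :=
        Finset.single_le_sum (f := fun a => ∑ b, (y a - y b) ^ 2)
          (fun a _ => Finset.sum_nonneg fun b _ => sq_nonneg _) (Finset.mem_univ i)
      linarith
    have hpos := mul_pos hprod hsum
    simp only [Set.mem_ofPred_eq, if_pos hdisc, Pi.zero_apply, ENNReal.ofReal_eq_zero, not_le]
    exact hpos
  · refine Measurable.ite (measurableSet_lt (disc_measurable m p αp) measurable_const) ?_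
      measurable_const
    fun_prop
end

section
/- Let E be a finite index set of hyperedges with sizes m_e ≥ 2 and selection probabilities p_e > 0, let c > 0, let d_p be the discordance, and let Δ*_{d_p}(c) be the minimum isolation distance. Let μ = Σ_k m_k δ_{a_k} be a purely atomic probability measure on ℝ with countably many distinct atoms a_k and all masses m_k > 0. Suppose that for every e ∈ E, ∫_{ℝ^{m_e}} 1{d_p(y) < c} Σ_{i=1}^{m_e} Σ_{j=1}^{m_e} (y_i − y_j)² dμ^{⊗m_e}(y) = 0. Then |a_k − a_l| ≥ Δ*_{d_p}(c) for all k ≠ l. -/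
open MeasureTheory
open scoped ENNReal

lemma disc_affine {ι : Type*} [Fintype ι] [Nonempty ι] (p αp : ℝ) (hp : 0 < p) (y : ι → ℝ)
    (b t : ℝ) : disc p αp (fun i => b + t * y i) = |t| * disc p αp y := by
  have hcard : (Fintype.card ι : ℝ) ≠ 0 := by exact_mod_cast Fintype.card_ne_zero
  have key : ∀ i, |b + t * y i - (1 / (Fintype.card ι : ℝ)) * ∑ j, (b + t * y j)| ^ p
      = |t| ^ p * |y i - (1 / (Fintype.card ι : ℝ)) * ∑ j, y j| ^ p := by
    intro i
    rw [← Real.mul_rpow (abs_nonneg _) (abs_nonneg _), ← abs_mul]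
    congr 2
    rw [Finset.sum_add_distrib, ← Finset.mul_sum, Finset.sum_const, Finset.card_univ, nsmul_eq_mul]
    field_simp
    ring
  unfold disc
  simp only [key]
  rw [← Finset.mul_sum, mul_left_comm, Real.mul_rpow (by positivity)
    (mul_nonneg (by positivity) (Finset.sum_nonneg fun i _ => by positivity)),
    ← Real.rpow_mul (abs_nonneg _), mul_one_div_cancel hp.ne', Real.rpow_one]
  ring

/-- separation of the atoms of a purely atomic steady state.
Let `μ = Σ_k m_k δ_{a_k}` be a purely atomic probability measure with countably many
distinct atoms `a_k` and masses `m_k > 0`, and suppose that for every hyperedge `e`,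
`∫ 1{d_p(y) < c} Σ_i Σ_j (y_i − y_j)² dμ^{⊗ m_e}(y) = 0`. Then any two atoms satisfy
`|a_k − a_l| ≥ Δ*_{d_p}(c)`, where `Δ*_{d_p}(c) = min_e Δ_e` and `Δ_e > 0` is the unique
positive real with `d_p((Δ_e, 0, …, 0)) = c` on `ℝ^{m_e}`. -/
theorem atoms_are_isolated {ι : Type*} [Fintype ι] [Nonempty ι]
    (msize : ι → ℕ) (hm : ∀ e, 2 ≤ msize e)
    (pE : ι → ℝ) (hpE : ∀ e, 0 < pE e) (hsum : ∑ e, pE e = 1)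
    (p αp c : ℝ) (hp : 0 < p) (hαp : 0 < αp) (hc : 0 < c)
    -- the minimum isolation distance: `Δ e > 0` is the unique positive real with
    -- `d_p((Δ e, 0, …, 0)) = c` on `ℝ^{m_e}`
    (Δ : ι → ℝ) (hΔpos : ∀ e, 0 < Δ e)
    (hΔ : ∀ e, disc p αp (fun i : Fin (msize e) => if i.val = 0 then Δ e else 0) = c)
    (hΔuniq : ∀ e, ∀ d : ℝ, 0 < d →
      disc p αp (fun i : Fin (msize e) => if i.val = 0 then d else 0) = c → d = Δ e)
    -- the purely atomic probability measure `μ = Σ_k m_k δ_{a_k}`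
    (κ : Type) [Countable κ] [MeasurableSpace κ]
    (a : κ → ℝ) (hainj : Function.Injective a)
    (mk : κ → ℝ≥0∞) (hmk : ∀ k, 0 < mk k)
    (μ : Measure ℝ) (hμdef : μ = Measure.sum (fun k => mk k • Measure.dirac (a k)))
    (hμprob : IsProbabilityMeasure μ)
    -- the interaction functional vanishes for every hyperedge
    (hzero : ∀ e : ι,
      ∫⁻ y : Fin (msize e) → ℝ,
        (if disc p αp y < c then ENNReal.ofReal (∑ i, ∑ j, (y i - y j) ^ 2) else 0)
        ∂(Measure.pi fun _ : Fin (msize e) => μ) = 0) :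
    ∀ k l : κ, k ≠ l →
      (Finset.univ.inf' Finset.univ_nonempty Δ) ≤ |a k - a l| := by
  intro k l hkl
  by_contra! hlt
  obtain ⟨e⟩ := ‹Nonempty ι›
  have hlt' : |a k - a l| < Δ e := lt_of_lt_of_le hlt (Finset.inf'_le _ (Finset.mem_univ e))
  have hme := hm e
  haveI : Nonempty (Fin (msize e)) := ⟨⟨0, by omega⟩⟩
  have hΔe := hΔpos e
  set y : Fin (msize e) → ℝ := fun i => if i.val = 0 then a k else a l with hy
  have hyeq : y = fun i => a l + ((a k - a l) / Δ e) * (if i.val = 0 then Δ e else 0) := by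
    funext i
    by_cases h : i.val = 0
    · simp only [hy, h, if_true]
      field_simp
      ring
    · simp [hy, h]
  have hdisc : disc p αp y < c := by
    rw [hyeq, disc_affine p αp hp (fun i : Fin (msize e) => if i.val = 0 then Δ e else 0),
      hΔ e, abs_div, abs_of_pos hΔe]
    have : |a k - a l| / Δ e < 1 := (div_lt_one hΔe).2 hlt'
    nlinarith
  have hne : a k - a l ≠ 0 := sub_ne_zero.2 (hainj.ne hkl)
  have hpos : 0 < ∑ i, ∑ j, (y i - y j) ^ 2 := by
    refine Finset.sum_pos' (fun i _ => Finset.sum_nonneg fun j _ => sq_nonneg _)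
      ⟨⟨0, by omega⟩, Finset.mem_univ _, ?_⟩
    refine Finset.sum_pos' (fun j _ => sq_nonneg _) ⟨⟨1, by omega⟩, Finset.mem_univ _, ?_⟩
    simp only [hy]
    simpa using sq_pos_of_ne_zero hne
  have hatom : ∀ q, 0 < μ {a q} := by
    intro q
    rw [hμdef, Measure.sum_apply _ (measurableSet_singleton _)]
    refine lt_of_lt_of_le (hmk q) (le_trans ?_ (ENNReal.le_tsum q))
    simp
  have hsing : (Measure.pi fun _ : Fin (msize e) => μ) {y} ≠ 0 := by
    rw [Measure.pi_singleton]
    refine Finset.prod_ne_zero_iff.2 fun i _ => ?_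
    simp only [hy]
    split_ifs
    · exact (hatom k).ne'
    · exact (hatom l).ne'
  have hle := setLIntegral_le_lintegral (μ := Measure.pi fun _ : Fin (msize e) => μ) {y}
    (fun y => if disc p αp y < c then ENNReal.ofReal (∑ i, ∑ j, (y i - y j) ^ 2) else 0)
  rw [hzero e, lintegral_singleton, if_pos hdisc] at hle
  have := mul_eq_zero.1 (le_antisymm hle (zero_le))
  rcases this with h | h
  · exact (ENNReal.ofReal_pos.2 hpos).ne' h
  · exact hsing h
end

section
/- Let g : ℝ × [0,∞) → [0,∞) satisfy the pointwise mean-field rate equation, suppose g(·, t) is a probability density for every t ≥ 0, suppose g(·, 0) has bounded support, and suppose g satisfies the weak-form rate equation for every convex observable φ and every bounded continuous observable φ. Then there exist a finite number K of points a_1 < a_2 < … < a_K in ℝ with a_{k+1} − a_k ≥ Δ*_{d_p}(c) for each k, and masses m_1, …, m_K > 0 with Σ_{k=1}^K m_k = 1, such that the probability measures g(a, t) da converge weakly, as t → ∞, to the purely atomic measure Σ_{k=1}^K m_k δ_{a_k}. -/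
open MeasureTheory

/-- The right-hand side of the pointwise mean-field rate equation (the paper's mean-field
rate equation with the Dirac deltas integrated out). -/
noncomputable def mfRHS {ι : Type*} [Fintype ι] (msize : ι → ℕ) (pE : ι → ℝ)
    (p αp c : ℝ) (g : ℝ → ℝ → ℝ) (a t : ℝ) : ℝ :=
  ∑ e : ι, pE e * (msize e : ℝ) *
    ((msize e : ℝ) * ∫ y : Fin (msize e - 1) → ℝ,
        (if disc p αp (Fin.cons ((msize e : ℝ) * a - ∑ j, y j) y) < c
         then g ((msize e : ℝ) * a - ∑ j, y j) t * ∏ j, g (y j) t else 0)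
     - g a t * ∫ y : Fin (msize e - 1) → ℝ,
        (if disc p αp (Fin.cons a y) < c then ∏ j, g (y j) t else 0))

/-- `g` satisfies the weak-form rate equation for the observable `φ`:
`t ↦ ∫ φ(a) g(a,t) da` is finite and differentiable with derivative `weakRHS φ t`. -/
def WeakForm {ι : Type*} [Fintype ι] (msize : ι → ℕ) (pE : ι → ℝ)
    (p αp c : ℝ) (g : ℝ → ℝ → ℝ) (φ : ℝ → ℝ) : Prop :=
  (∀ t : ℝ, 0 ≤ t → Integrable (fun a => φ a * g a t)) ∧
  (∀ t : ℝ, 0 ≤ t →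
    HasDerivAt (fun s => ∫ a, φ a * g a s) (weakRHS msize pE p αp c g φ t) t)

open Filter Topology

lemma mf_disc_continuous {m : ℕ} {p αp : ℝ} (hp : 0 < p) :
    Continuous (fun y : Fin m → ℝ => disc p αp y) := by
  unfold disc
  refine continuous_const.mul (Continuous.rpow_const ?_ (fun _ => Or.inr (by positivity)))
  refine continuous_const.mul (continuous_finsetSum _ fun i _ => ?_)
  refine Continuous.rpow_const ?_ (fun _ => Or.inr hp.le)
  fun_prop

lemma mf_disc_affine {m : ℕ} (hm : 2 ≤ m) {p αp : ℝ} (hp : 0 < p) (x s : ℝ) (hs : 0 ≤ s)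
    (w : Fin m → ℝ) :
    disc p αp (fun i => x + s * w i) = s * disc p αp w := by
  have hm0 : (m : ℝ) ≠ 0 := by positivity
  unfold disc
  simp only [Fintype.card_fin]
  have h1 : ∀ i, |x + s * w i - 1 / (m : ℝ) * ∑ j, (x + s * w j)| ^ p
      = s ^ p * |w i - 1 / (m : ℝ) * ∑ j, w j| ^ p := by
    intro i
    rw [← Real.mul_rpow hs (abs_nonneg _)]
    congr 1
    rw [Finset.sum_add_distrib, ← Finset.mul_sum]
    have h2 : s * |w i - 1 / (m : ℝ) * ∑ j, w j| = |s * (w i - 1 / (m : ℝ) * ∑ j, w j)| := by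
      rw [abs_mul, abs_of_nonneg hs]
    rw [h2]
    congr 1
    simp
    field_simp
    ring
  simp_rw [h1]
  rw [← Finset.mul_sum, mul_left_comm, Real.mul_rpow (by positivity)
    (mul_nonneg (by positivity) (Finset.sum_nonneg fun i _ => by positivity)),
    ← Real.rpow_mul hs, mul_one_div_cancel hp.ne', Real.rpow_one]
  ring

lemma mf_jensen {m : ℕ} (hm : 2 ≤ m) {φ : ℝ → ℝ} (hφ : ConvexOn ℝ Set.univ φ)
    (y : Fin m → ℝ) :
    φ ((1 / (m : ℝ)) * ∑ i, y i) - (1 / (m : ℝ)) * ∑ i, φ (y i) ≤ 0 := by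
  have hm0 : (m : ℝ) ≠ 0 := by positivity
  have := hφ.map_sum_le (t := Finset.univ) (w := fun _ : Fin m => 1 / (m : ℝ)) (p := y)
    (fun _ _ => by positivity) (by simp [hm0]) (fun _ _ => Set.mem_univ _)
  simp only [smul_eq_mul, ← Finset.mul_sum] at this
  linarith

lemma mf_weak_term_nonpos {m : ℕ} (hm : 2 ≤ m) {p αp c t : ℝ} {g : ℝ → ℝ → ℝ}
    (hg : ∀ a, 0 ≤ g a t) {φ : ℝ → ℝ} (hφ : ConvexOn ℝ Set.univ φ) (y : Fin m → ℝ) :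
    (if disc p αp y < c then
        (∏ i, g (y i) t) *
          (φ ((1 / (m : ℝ)) * ∑ i, y i) - (1 / (m : ℝ)) * ∑ i, φ (y i))
       else 0) ≤ 0 := by
  split_ifs
  · exact mul_nonpos_of_nonneg_of_nonpos (Finset.prod_nonneg fun i _ => hg _) (mf_jensen hm hφ y)
  · exact le_rfl

/-- tent function -/
noncomputable def mfTent (x ε z : ℝ) : ℝ := max 0 (1 - |z - x| / ε)

lemma mfTent_continuous (x ε : ℝ) : Continuous (mfTent x ε) := by
  unfold mfTent; fun_prop

lemma mfTent_nonneg (x ε z : ℝ) : 0 ≤ mfTent x ε z := le_max_left _ _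

lemma mfTent_le_one {x ε : ℝ} (hε : 0 < ε) (z : ℝ) : mfTent x ε z ≤ 1 := by
  unfold mfTent
  have : 0 ≤ |z - x| / ε := by positivity
  exact max_le zero_le_one (by linarith)

lemma mfTent_zero {x ε z : ℝ} (hε : 0 < ε) (h : ε ≤ |z - x|) : mfTent x ε z = 0 := by
  unfold mfTent
  have : 1 ≤ |z - x| / ε := by rwa [le_div_iff₀ hε, one_mul]
  exact max_eq_left (by linarith)

lemma mfTent_self (x ε : ℝ) : mfTent x ε x = 1 := by simp [mfTent]

lemma mfTent_half {x ε z : ℝ} (hε : 0 < ε) (h : |z - x| ≤ ε / 2) : 1 / 2 ≤ mfTent x ε z := by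
  unfold mfTent
  have : |z - x| / ε ≤ 1 / 2 := by rw [div_le_iff₀ hε]; linarith
  exact le_max_of_le_right (by linarith)

lemma mf_var_pos {m : ℕ} (hm : 2 ≤ m) (x s : ℝ) (hs : 0 < s) :
    0 < (1 / (m : ℝ)) * ∑ i : Fin m, (x + s * (if i.val = 0 then 1 else 0)) ^ 2
      - ((1 / (m : ℝ)) * ∑ i : Fin m, (x + s * (if i.val = 0 then 1 else 0))) ^ 2 := by
  obtain ⟨n, rfl⟩ : ∃ n, m = n + 1 + 1 := ⟨m - 2, by omega⟩
  simp only [Fin.sum_univ_succ (n := n + 1), Fin.val_zero, Fin.val_succ, Nat.add_eq_zero_iff,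
    one_ne_zero, and_false, if_true, if_false, mul_one, mul_zero, add_zero, Finset.sum_const,
    Finset.card_univ, Fintype.card_fin, nsmul_eq_mul, Nat.cast_add, Nat.cast_one]
  have : 0 < s ^ 2 * (n + 1) / (((n : ℝ) + 1 + 1)) ^ 2 := by positivity
  convert this using 1
  field_simp
  ring

/-- Abstract part: monotone convex functionals and separation give cluster convergence. -/
lemma mf_abstract (g : ℝ → ℝ → ℝ) (R : ℝ)
    (hcont : ∀ t, Continuous fun a => g a t)
    (hdens : ∀ t : ℝ, 0 ≤ t →
      (∀ a, 0 ≤ g a t) ∧ Integrable (fun a => g a t) ∧ (∫ a, g a t) = 1)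
    (hsupp : ∀ t, 0 ≤ t → ∀ a : ℝ, R < |a| → g a t = 0)
    (hanti : ∀ φ : ℝ → ℝ, ConvexOn ℝ Set.univ φ →
      AntitoneOn (fun t => ∫ x, φ x * g x t) (Set.Ici 0))
    (D : ℝ) (hD : 0 < D)
    (hsep : ∀ x y, x < y →
      (∀ ε > 0, ∃ η > 0, ∀ᶠ t in atTop, η ≤ ∫ z, mfTent x ε z * g z t) →
      (∀ ε > 0, ∃ η > 0, ∀ᶠ t in atTop, η ≤ ∫ z, mfTent y ε z * g z t) → D ≤ y - x) :
    ∃ (K : ℕ) (a : Fin K → ℝ) (mk : Fin K → ℝ),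
      StrictMono a ∧
      (∀ k l : Fin K, k < l → D ≤ a l - a k) ∧
      (∀ k, 0 < mk k) ∧ (∑ k, mk k) = 1 ∧
      (∀ φ : ℝ → ℝ, Continuous φ →
        Tendsto (fun t => ∫ x, φ x * g x t) atTop (𝓝 (∑ k, mk k * φ (a k)))) := by
  have hint : ∀ φ : ℝ → ℝ, Continuous φ → ∀ t, 0 ≤ t → Integrable (fun x => φ x * g x t) := by
    intro φ hφ t ht
    refine Continuous.integrable_of_hasCompactSupport (hφ.mul (hcont t)) ?_
    refine HasCompactSupport.intro (isCompact_Icc (a := -R) (b := R)) fun x hx => ?_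
    rw [hsupp t ht x, mul_zero]
    by_contra h
    exact hx (abs_le.1 (not_lt.1 h))
  -- monotonicity
  have hmono : ∀ φ ψ : ℝ → ℝ, Continuous φ → Continuous ψ → (∀ x, |x| ≤ R → φ x ≤ ψ x) →
      ∀ t, 0 ≤ t → ∫ x, φ x * g x t ≤ ∫ x, ψ x * g x t := by
    intro φ ψ hφ hψ h t ht
    refine integral_mono (hint φ hφ t ht) (hint ψ hψ t ht) fun x => ?_
    rcases le_or_gt |x| R with hx | hx
    · exact mul_le_mul_of_nonneg_right (h x hx) ((hdens t ht).1 x)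
    · simp [hsupp t ht x hx]
  have hconst : ∀ C t, 0 ≤ t → ∫ x, C * g x t = C := by
    intro C t ht
    rw [integral_const_mul, (hdens t ht).2.2, mul_one]
  have hbdd : ∀ φ : ℝ → ℝ, Continuous φ → ∃ M, 0 < M ∧ ∀ x, |x| ≤ R → |φ x| ≤ M := by
    intro φ hφ
    obtain ⟨M, hM⟩ := (isCompact_Icc (a := -R) (b := R)).exists_bound_of_continuousOn hφ.continuousOn
    exact ⟨max M 1, by positivity, fun x hx => le_max_of_le_left (hM x (abs_le.1 hx))⟩
  -- convex convergence
  have hconv : ∀ φ : ℝ → ℝ, Continuous φ → ConvexOn ℝ Set.univ φ →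
      ∃ l, Tendsto (fun t => ∫ x, φ x * g x t) atTop (𝓝 l) := by
    intro φ hφ hc
    obtain ⟨M, hM0, hM⟩ := hbdd φ hφ
    have ha : Antitone (fun t => ∫ x, φ x * g x (max t 0)) := fun s t hst =>
      hanti φ hc (Set.mem_Ici.2 (le_max_right s 0)) (Set.mem_Ici.2 (le_max_right t 0))
        (max_le_max_right 0 hst)
    have hb : BddBelow (Set.range (fun t => ∫ x, φ x * g x (max t 0))) := by
      refine ⟨-M, ?_⟩
      rintro _ ⟨t, rfl⟩
      have := hmono (fun _ => -M) φ continuous_const hφ (fun x hx => (abs_le.1 (hM x hx)).1)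
        (max t 0) (le_max_right _ _)
      rwa [hconst _ _ (le_max_right _ _)] at this
    refine ⟨_, (tendsto_atTop_ciInf ha hb).congr' ?_⟩
    filter_upwards [eventually_ge_atTop 0] with t ht
    rw [max_eq_left ht]
  -- polynomials in exp
  have hpoly : ∀ P : Polynomial ℝ,
      ∃ l, Tendsto (fun t => ∫ x, P.eval (Real.exp x) * g x t) atTop (𝓝 l) := by
    intro P
    have hk : ∀ k : ℕ, ∃ l, Tendsto (fun t => ∫ x, Real.exp x ^ k * g x t) atTop (𝓝 l) := by
      intro k
      refine hconv _ (by fun_prop) ?_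
      exact (convexOn_exp.pow (fun x _ => (Real.exp_pos x).le) k)
    choose l hl using hk
    refine ⟨∑ k ∈ Finset.range (P.natDegree + 1), P.coeff k * l k, ?_⟩
    refine (tendsto_finsetSum _ fun k _ => (hl k).const_mul (P.coeff k)).congr' ?_
    filter_upwards [eventually_ge_atTop 0] with t ht
    simp_rw [← integral_const_mul]
    rw [← integral_finsetSum _ fun k _ => (hint _ (by fun_prop) t ht).const_mul _]
    congr 1
    ext x
    rw [Polynomial.eval_eq_sum_range, Finset.sum_mul]
    exact Finset.sum_congr rfl fun k _ => by ring
  have hlim : ∀ φ : ℝ → ℝ, Continuous φ →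
      ∃ l, Tendsto (fun t => ∫ x, φ x * g x t) atTop (𝓝 l) := by
    intro φ hφ
    refine cauchySeq_tendsto_of_complete (Metric.cauchySeq_iff'.2 fun ε hε => ?_)
    obtain ⟨P, hP⟩ := exists_polynomial_near_of_continuousOn (Real.exp (-R)) (Real.exp R)
      (fun u => φ (Real.log u)) (by
        refine hφ.comp_continuousOn (Real.continuousOn_log.mono ?_)
        intro u hu
        exact (lt_of_lt_of_le (Real.exp_pos _) hu.1).ne') (ε / 4) (by positivity)
    have hPx : ∀ x, |x| ≤ R → |P.eval (Real.exp x) - φ x| < ε / 4 := by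
      intro x hx
      have h := hP (Real.exp x) ⟨Real.exp_le_exp.2 (abs_le.1 hx).1, Real.exp_le_exp.2 (abs_le.1 hx).2⟩
      rwa [Real.log_exp] at h
    have hPc : Continuous fun x => P.eval (Real.exp x) := P.continuous.comp Real.continuous_exp
    have hnear : ∀ t, 0 ≤ t → |(∫ x, P.eval (Real.exp x) * g x t) - ∫ x, φ x * g x t| ≤ ε / 4 := by
      intro t ht
      rw [← integral_sub (hint _ hPc t ht) (hint _ hφ t ht)]
      simp_rw [← sub_mul]
      rw [abs_le]
      constructor
      · rw [← hconst (-(ε/4)) t ht]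
        exact hmono (fun _ => -(ε/4)) _ continuous_const (hPc.sub hφ)
          (fun x hx => (abs_lt.1 (hPx x hx)).1.le) t ht
      · rw [← hconst (ε/4) t ht]
        exact hmono _ (fun _ => (ε/4)) (hPc.sub hφ) continuous_const
          (fun x hx => (abs_lt.1 (hPx x hx)).2.le) t ht
    obtain ⟨l, hl⟩ := hpoly P
    obtain ⟨N, hN⟩ := Metric.cauchySeq_iff'.1 hl.cauchySeq (ε / 4) (by positivity)
    refine ⟨max N 0, fun t ht => ?_⟩
    have h1 := hN t (le_trans (le_max_left _ _) ht)
    have h2 := hN (max N 0) (le_max_left _ _)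
    have h3 := hnear t (le_trans (le_max_right _ _) ht)
    have h4 := hnear (max N 0) (le_max_right _ _)
    rw [Real.dist_eq, abs_lt] at *
    rw [abs_le] at h3 h4
    constructor <;> linarith
  choose! L hL using hlim
  have hLmono : ∀ φ ψ : ℝ → ℝ, Continuous φ → Continuous ψ → (∀ x, |x| ≤ R → φ x ≤ ψ x) →
      L φ ≤ L ψ := by
    intro φ ψ hφ hψ h
    refine le_of_tendsto_of_tendsto (hL φ hφ) (hL ψ hψ) ?_
    filter_upwards [eventually_ge_atTop 0] with t ht
    exact hmono φ ψ hφ hψ h t ht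
  have hLconst : ∀ C, L (fun _ => C) = C := by
    intro C
    refine tendsto_nhds_unique (hL _ continuous_const) (tendsto_const_nhds.congr' ?_)
    filter_upwards [eventually_ge_atTop 0] with t ht
    exact (hconst C t ht).symm
  have hLadd : ∀ φ ψ : ℝ → ℝ, Continuous φ → Continuous ψ →
      L (fun x => φ x + ψ x) = L φ + L ψ := by
    intro φ ψ hφ hψ
    refine tendsto_nhds_unique (hL _ (hφ.add hψ)) (((hL φ hφ).add (hL ψ hψ)).congr' ?_)
    filter_upwards [eventually_ge_atTop 0] with t ht
    rw [← integral_add (hint _ hφ t ht) (hint _ hψ t ht)]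
    simp_rw [add_mul]
  have hLmul : ∀ (C : ℝ) (φ : ℝ → ℝ), Continuous φ → L (fun x => C * φ x) = C * L φ := by
    intro C φ hφ
    refine tendsto_nhds_unique (hL _ (continuous_const.mul hφ)) (((hL φ hφ).const_mul C).congr' ?_)
    filter_upwards with t
    rw [← integral_const_mul]
    simp_rw [mul_assoc]
  have hLnonneg : ∀ φ : ℝ → ℝ, Continuous φ → (∀ x, |x| ≤ R → 0 ≤ φ x) → 0 ≤ L φ := by
    intro φ hφ h
    rw [← hLconst 0]
    exact hLmono _ _ continuous_const hφ h
  have hLsum : ∀ {K : ℕ} (φ : Fin K → ℝ → ℝ), (∀ k, Continuous (φ k)) →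
      L (fun x => ∑ k, φ k x) = ∑ k, L (φ k) := by
    intro K φ hφ
    refine tendsto_nhds_unique (hL _ (continuous_finsetSum _ fun k _ => hφ k))
      ((tendsto_finsetSum _ fun k _ => hL (φ k) (hφ k)).congr' ?_)
    filter_upwards [eventually_ge_atTop 0] with t ht
    rw [← integral_finsetSum _ fun k _ => hint _ (hφ k) t ht]
    simp_rw [Finset.sum_mul]
  -- the support
  set S : Set ℝ := {x | ∀ ε > 0, 0 < L (mfTent x ε)} with hS
  have hSD : ∀ x ∈ S, ∀ y ∈ S, x < y → D ≤ y - x := by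
    have key : ∀ x ∈ S, ∀ ε > 0, ∃ η > 0, ∀ᶠ t in atTop, η ≤ ∫ z, mfTent x ε z * g z t := by
      intro x hx ε hε
      refine ⟨L (mfTent x ε) / 2, half_pos (hx ε hε), ?_⟩
      filter_upwards [(hL _ (mfTent_continuous x ε)).eventually
        (lt_mem_nhds (half_lt_self (hx ε hε)))] with t ht using ht.le
    intro x hx y hy hxy
    exact hsep x y hxy (key x hx) (key y hy)
  have hSR : ∀ x ∈ S, |x| ≤ R := by
    intro x hx
    by_contra h
    push Not at h
    have h0 := hx (|x| - R) (by linarith)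
    have : L (mfTent x (|x| - R)) ≤ L (fun _ => 0) := by
      refine hLmono _ _ (mfTent_continuous _ _) continuous_const fun z hz => ?_
      rw [mfTent_zero (by linarith)]
      have := abs_sub_abs_le_abs_sub x z
      rw [abs_sub_comm] at this
      linarith
    rw [hLconst] at this
    linarith
  have hSfin : S.Finite := by
    refine Set.Finite.of_finite_image (f := fun x => ⌊x / D⌋) ?_ ?_
    · refine (Set.finite_Icc ⌊-R / D⌋ ⌊R / D⌋).subset ?_
      rintro _ ⟨x, hx, rfl⟩
      have := abs_le.1 (hSR x hx)
      exact ⟨Int.floor_le_floor (by gcongr; exact this.1), Int.floor_le_floor (by gcongr; exact this.2)⟩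
    · have key : ∀ x ∈ S, ∀ y ∈ S, x < y → ⌊x / D⌋ ≠ ⌊y / D⌋ := by
        intro x hx y hy hxy h
        have h1 := hSD x hx y hy hxy
        have h2 := Int.abs_sub_lt_one_of_floor_eq_floor h
        rw [abs_sub_comm, ← sub_div, abs_lt, div_lt_one hD] at h2
        linarith
      intro x hx y hy h
      rcases lt_trichotomy x y with hxy | hxy | hxy
      · exact absurd h (key x hx y hy hxy)
      · exact hxy
      · exact absurd h.symm (key y hy x hx hxy)
  -- functions vanishing on S
  have hvanish : ∀ φ : ℝ → ℝ, Continuous φ → (∀ x ∈ S, φ x = 0) → L φ = 0 := by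
    intro φ hφ h0
    obtain ⟨M, hM0, hM⟩ := hbdd φ hφ
    have hsmall : ∀ δ > 0, |L φ| ≤ δ := by
      intro δ hδ
      have hC : IsCompact (Set.Icc (-R) R ∩ {x | δ ≤ |φ x|}) :=
        isCompact_Icc.inter_right (isClosed_le continuous_const hφ.abs)
      obtain ⟨ψ, hψ, hψ0, hψ1, hψL⟩ : ∃ ψ : ℝ → ℝ, Continuous ψ ∧ (∀ x, 0 ≤ ψ x) ∧
          (∀ x ∈ Set.Icc (-R) R ∩ {x | δ ≤ |φ x|}, 1 ≤ ψ x) ∧ L ψ = 0 := by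
        refine hC.induction_on (p := fun s => ∃ ψ : ℝ → ℝ, Continuous ψ ∧ (∀ x, 0 ≤ ψ x) ∧
          (∀ x ∈ s, 1 ≤ ψ x) ∧ L ψ = 0) ?_ ?_ ?_ ?_
        · exact ⟨fun _ => 0, continuous_const, fun _ => le_rfl, by simp, hLconst 0⟩
        · rintro s t hst ⟨ψ, h1, h2, h3, h4⟩
          exact ⟨ψ, h1, h2, fun x hx => h3 x (hst hx), h4⟩
        · rintro s t ⟨ψ, h1, h2, h3, h4⟩ ⟨ψ', h1', h2', h3', h4'⟩
          refine ⟨fun x => ψ x + ψ' x, h1.add h1', fun x => add_nonneg (h2 x) (h2' x), ?_, ?_⟩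
          · rintro x (hx | hx)
            · linarith [h3 x hx, h2' x]
            · linarith [h3' x hx, h2 x]
          · rw [hLadd _ _ h1 h1', h4, h4', add_zero]
        · rintro x ⟨-, hx⟩
          have hxS : x ∉ S := fun hxS => by
            have hx' : δ ≤ |φ x| := hx
            rw [h0 x hxS, abs_zero] at hx'
            linarith
          simp only [hS, Set.mem_ofPred_eq, not_forall, not_lt] at hxS
          obtain ⟨ε, hε, hLε⟩ := hxS
          have hLε0 : L (mfTent x ε) = 0 := le_antisymm hLε
            (hLnonneg _ (mfTent_continuous _ _) fun z _ => mfTent_nonneg _ _ _)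
          refine ⟨Metric.ball x (ε / 2), mem_nhdsWithin_of_mem_nhds
            (Metric.ball_mem_nhds x (half_pos hε)), fun z => 2 * mfTent x ε z,
            continuous_const.mul (mfTent_continuous _ _),
            fun z => mul_nonneg zero_le_two (mfTent_nonneg _ _ _), ?_, ?_⟩
          · intro z hz
            rw [Metric.mem_ball, Real.dist_eq] at hz
            have := mfTent_half hε hz.le
            linarith
          · rw [hLmul _ _ (mfTent_continuous _ _), hLε0, mul_zero]
      have hb : ∀ x, |x| ≤ R → |φ x| ≤ δ + M * ψ x := by
        intro x hx
        have hp := mul_nonneg hM0.le (hψ0 x)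
        rcases le_or_gt δ |φ x| with h | h
        · have := hψ1 x ⟨abs_le.1 hx, h⟩
          nlinarith [hM x hx]
        · linarith
      have hLb : L (fun x => δ + M * ψ x) = δ := by
        rw [hLadd (fun _ => δ) (fun x => M * ψ x) continuous_const (continuous_const.mul hψ), hLconst, hLmul _ _ hψ, hψL]
        ring
      have hcb : Continuous fun x => δ + M * ψ x := by fun_prop
      rw [abs_le]
      constructor
      · have h1 := hLmono (fun x => (-1) * (δ + M * ψ x)) φ (by fun_prop) hφ
          (fun x hx => by linarith [(abs_le.1 (hb x hx)).1])
        rw [hLmul _ _ hcb, hLb] at h1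
        linarith
      · have h1 := hLmono φ _ hφ hcb (fun x hx => (abs_le.1 (hb x hx)).2)
        rwa [hLb] at h1
    by_contra h
    have := hsmall (|L φ| / 2) (by positivity)
    have : 0 < |L φ| := by positivity
    linarith
  set T := hSfin.toFinset with hT
  let a : Fin T.card → ℝ := fun k => T.orderEmbOfFin rfl k
  have haS : ∀ k, a k ∈ S := fun k => hSfin.mem_toFinset.1 (T.orderEmbOfFin_mem rfl k)
  have ha : StrictMono a := (T.orderEmbOfFin rfl).strictMono
  have hgap : ∀ k l, k < l → D ≤ a l - a k := fun k l hkl =>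
    hSD _ (haS k) _ (haS l) (ha hkl)
  have htent : ∀ k l, mfTent (a k) D (a l) = if k = l then 1 else 0 := by
    intro k l
    split_ifs with h
    · rw [h, mfTent_self]
    · refine mfTent_zero hD ?_
      rcases lt_or_gt_of_ne h with h | h
      · exact (hgap _ _ h).trans (le_abs_self _)
      · rw [abs_sub_comm]
        exact (hgap _ _ h).trans (le_abs_self _)
  have hrep : ∀ φ : ℝ → ℝ, Continuous φ → L φ = ∑ k, L (mfTent (a k) D) * φ (a k) := by
    intro φ hφ
    have hs : Continuous fun x => ∑ k, φ (a k) * mfTent (a k) D x :=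
      continuous_finsetSum _ fun k _ => continuous_const.mul (mfTent_continuous _ _)
    have h1 := hvanish (fun x => φ x + (-1) * ∑ k, φ (a k) * mfTent (a k) D x)
      (hφ.add (continuous_const.mul hs)) (by
        intro x hx
        obtain ⟨l, rfl⟩ : ∃ l, a l = x := by
          have : x ∈ Set.range (T.orderEmbOfFin rfl) := by
            rw [Finset.range_orderEmbOfFin]
            exact hSfin.mem_toFinset.2 hx
          exact this
        simp [htent])
    rw [hLadd φ (fun x => (-1) * ∑ k, φ (a k) * mfTent (a k) D x) hφ
      (continuous_const.mul hs), hLmul _ _ hs,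
      hLsum (fun k x => φ (a k) * mfTent (a k) D x) (fun k => continuous_const.mul (mfTent_continuous _ _))] at h1
    have h2 : ∀ k, L (fun x => φ (a k) * mfTent (a k) D x) = L (mfTent (a k) D) * φ (a k) := by
      intro k
      rw [hLmul _ _ (mfTent_continuous _ _), mul_comm]
    simp_rw [h2] at h1
    linarith
  refine ⟨T.card, a, fun k => L (mfTent (a k) D), ha, hgap, fun k => haS k D hD, ?_, ?_⟩
  · have := hrep (fun _ => 1) continuous_const
    rw [hLconst] at this
    simpa using this.symm
  · intro φ hφ
    rw [← hrep φ hφ]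
    exact hL φ hφ

/-- Local lower bound for the variance near an interacting configuration. -/
lemma mf_local {m : ℕ} (hm : 2 ≤ m) {p αp c Δ : ℝ} (hp : 0 < p) (hcpos : 0 < c) (hΔ0 : 0 < Δ)
    (hΔ : disc p αp (fun i : Fin m => if i.val = 0 then Δ else 0) = c)
    (x y : ℝ) (hxy : x < y) (hlt : y - x < Δ) :
    ∃ δ > 0, ∃ ε > 0, ∀ z : Fin m → ℝ,
      (∀ i : Fin m, |z i - (if i.val = 0 then y else x)| < ε) →
      disc p αp z < c ∧ ((1 / (m : ℝ)) * ∑ i, z i) ^ 2 - (1 / (m : ℝ)) * ∑ i, z i ^ 2 ≤ -δ := by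
  have hs : 0 < y - x := by linarith
  set w : Fin m → ℝ := fun i => if i.val = 0 then 1 else 0 with hw
  set z₀ : Fin m → ℝ := fun i => x + (y - x) * w i with hz₀
  have hc' : Δ * disc p αp w = c := by
    rw [← hΔ, ← mf_disc_affine hm hp 0 Δ hΔ0.le w]
    congr 1
    ext i
    simp [hw]
  have hv := mf_var_pos hm x (y - x) hs
  set V : (Fin m → ℝ) → ℝ := fun z => (1 / (m : ℝ)) * ∑ i, z i ^ 2
    - ((1 / (m : ℝ)) * ∑ i, z i) ^ 2 with hV
  have hv' : 0 < V z₀ := hv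
  have hd : disc p αp z₀ < c := by
    rw [hz₀, mf_disc_affine hm hp x (y - x) hs.le w]
    have : 0 < disc p αp w := pos_of_mul_pos_right (hc' ▸ hcpos) hΔ0.le
    calc _ < Δ * disc p αp w := by gcongr
      _ = c := hc'
  have hVc : Continuous V := by rw [hV]; fun_prop
  have hopen : IsOpen {z : Fin m → ℝ | disc p αp z < c ∧ V z₀ / 2 < V z} :=
    (isOpen_lt (mf_disc_continuous hp) continuous_const).inter (isOpen_lt continuous_const hVc)
  obtain ⟨ε, hε, hball⟩ := Metric.isOpen_iff.1 hopen z₀ ⟨hd, half_lt_self hv'⟩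
  refine ⟨V z₀ / 2, half_pos hv', ε, hε, fun z hz => ?_⟩
  have hmem : z ∈ Metric.ball z₀ ε := by
    rw [Metric.mem_ball, dist_pi_lt_iff hε]
    intro i
    rw [Real.dist_eq]
    convert hz i using 3
    simp only [hz₀, hw]
    split_ifs <;> ring
  obtain ⟨h1, h2⟩ := hball hmem
  refine ⟨h1, ?_⟩
  simp only [hV] at h2 ⊢
  linarith

lemma mf_dissipation {m : ℕ} (hm : 2 ≤ m) {p αp c t R x y ε δ η : ℝ} {g : ℝ → ℝ → ℝ}
    (hp : 0 < p) (hcont : Continuous fun a => g a t)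
    (hdens : (∀ a, 0 ≤ g a t) ∧ Integrable (fun a => g a t) ∧ (∫ a, g a t) = 1)
    (hsupp : ∀ a : ℝ, R < |a| → g a t = 0)
    (hε : 0 < ε) (hδ : 0 ≤ δ)
    (hloc : ∀ z : Fin m → ℝ, (∀ i : Fin m, |z i - (if i.val = 0 then y else x)| < ε) →
      disc p αp z < c ∧ ((1 / (m : ℝ)) * ∑ i, z i) ^ 2 - (1 / (m : ℝ)) * ∑ i, z i ^ 2 ≤ -δ)
    (hη : 0 ≤ η) (hx : η ≤ ∫ z, mfTent x ε z * g z t) (hy : η ≤ ∫ z, mfTent y ε z * g z t) :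
    ∫ z : Fin m → ℝ, (if disc p αp z < c then (∏ i, g (z i) t) *
      (((1 / (m : ℝ)) * ∑ i, z i) ^ 2 - (1 / (m : ℝ)) * ∑ i, (z i) ^ 2) else 0)
      ≤ -(δ * η ^ m) := by
  have hsq : ConvexOn ℝ Set.univ (fun x : ℝ => x ^ 2) := even_two.convexOn_pow
  have hg := hdens.1
  set b : Fin m → ℝ := fun i => if i.val = 0 then y else x with hb
  set F : (Fin m → ℝ) → ℝ := fun z => if disc p αp z < c then (∏ i, g (z i) t) *
      (((1 / (m : ℝ)) * ∑ i, z i) ^ 2 - (1 / (m : ℝ)) * ∑ i, (z i) ^ 2) else 0 with hF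
  have hcs : Continuous fun z : Fin m → ℝ => (∏ i, g (z i) t) *
      (((1 / (m : ℝ)) * ∑ i, z i) ^ 2 - (1 / (m : ℝ)) * ∑ i, (z i) ^ 2) := by
    refine Continuous.mul (continuous_finsetProd _ fun i _ => hcont.comp (continuous_apply i)) ?_
    fun_prop
  have hFint : Integrable F := by
    have h1 : Integrable fun z : Fin m → ℝ => (∏ i, g (z i) t) *
      (((1 / (m : ℝ)) * ∑ i, z i) ^ 2 - (1 / (m : ℝ)) * ∑ i, (z i) ^ 2) := by
      refine hcs.integrable_of_hasCompactSupport ?_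
      refine HasCompactSupport.intro
        (isCompact_univ_pi fun _ : Fin m => isCompact_Icc (a := -R) (b := R)) fun z hz => ?_
      simp only [Set.mem_univ_pi, not_forall] at hz
      obtain ⟨i, hi⟩ := hz
      rw [Finset.prod_eq_zero (Finset.mem_univ i), zero_mul]
      refine hsupp _ ?_
      by_contra h
      exact hi (abs_le.1 (not_lt.1 h))
    have hms : MeasurableSet {z : Fin m → ℝ | disc p αp z < c} :=
      (isOpen_lt (mf_disc_continuous hp) continuous_const).measurableSet
    refine (h1.indicator hms).congr (Eventually.of_forall fun z => ?_)
    simp [F, Set.indicator_apply]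
  have hGint : Integrable fun z : Fin m → ℝ => ∏ i, (mfTent (b i) ε (z i) * g (z i) t) := by
    refine Integrable.fintype_prod (f := fun i a => mfTent (b i) ε a * g a t) fun i => ?_
    refine Continuous.integrable_of_hasCompactSupport ((mfTent_continuous _ _).mul hcont) ?_
    refine HasCompactSupport.intro (isCompact_Icc (a := -R) (b := R)) fun z hz => ?_
    rw [hsupp z, mul_zero]
    by_contra h
    exact hz (abs_le.1 (not_lt.1 h))
  have hle : ∀ z, F z ≤ -δ * ∏ i, (mfTent (b i) ε (z i) * g (z i) t) := by
    intro z
    by_cases hz : ∀ i, |z i - b i| < ε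
    · obtain ⟨h1, h2⟩ := hloc z hz
      simp only [hF, if_pos h1]
      have hP : 0 ≤ ∏ i, g (z i) t := Finset.prod_nonneg fun i _ => hg _
      have h3 : ∏ i, (mfTent (b i) ε (z i) * g (z i) t) ≤ ∏ i, g (z i) t :=
        Finset.prod_le_prod (fun i _ => mul_nonneg (mfTent_nonneg _ _ _) (hg _))
          fun i _ => mul_le_of_le_one_left (hg _) (mfTent_le_one hε _)
      have h4 := mul_le_mul_of_nonneg_left h2 hP
      have h5 := mul_le_mul_of_nonneg_left h3 hδ
      linarith
    · push Not at hz
      obtain ⟨i, hi⟩ := hz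
      have h0 : ∏ i, (mfTent (b i) ε (z i) * g (z i) t) = 0 :=
        Finset.prod_eq_zero (Finset.mem_univ i) (by rw [mfTent_zero hε hi, zero_mul])
      rw [h0, mul_zero]
      exact mf_weak_term_nonpos hm hg hsq z
  have hI := integral_mono hFint (hGint.const_mul (-δ)) hle
  rw [integral_const_mul,
    integral_fintype_prod_volume_eq_prod (fun i a => mfTent (b i) ε a * g a t)] at hI
  have hprod : η ^ m ≤ ∏ i : Fin m, ∫ a, mfTent (b i) ε a * g a t := by
    calc η ^ m = ∏ _i : Fin m, η := by simp
      _ ≤ _ := Finset.prod_le_prod (fun _ _ => hη) fun i _ => by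
        simp only [hb]
        split_ifs
        · exact hy
        · exact hx
  have := mul_le_mul_of_nonneg_left hprod hδ
  linarith

/-- convergence to noninteracting opinion clusters. Let `g` satisfy the
pointwise mean-field rate equation, be a probability density for each `t ≥ 0` with
compactly supported initial data, and satisfy the weak-form rate equation for every
convex observable and every bounded continuous observable. Then there are finitely many
points `a_1 < ⋯ < a_K` with consecutive gaps at least the minimum isolation distance
`Δ*_{d_p}(c)` and masses `m_k > 0` summing to `1` such that the measures `g(a,t) da`
converge weakly, as `t → ∞`, to `Σ_k m_k δ_{a_k}`. -/
theorem meanfield_convergence_to_clusters {ι : Type*} [Fintype ι] [Nonempty ι]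
    (msize : ι → ℕ) (hm : ∀ e, 2 ≤ msize e)
    (pE : ι → ℝ) (hpE : ∀ e, 0 ≤ pE e) (hsum : ∑ e, pE e = 1)
    (p αp c : ℝ) (hp : 0 < p) (hαp : 0 < αp) (hc : 0 < c)
    -- the minimum isolation distance: `Δ e > 0` is the unique positive real with
    -- `d_p((Δ e, 0, …, 0)) = c` on `ℝ^{m_e}`
    (Δ : ι → ℝ) (hΔpos : ∀ e, 0 < Δ e)
    (hΔ : ∀ e, disc p αp (fun i : Fin (msize e) => if i.val = 0 then Δ e else 0) = c)
    (hΔuniq : ∀ e, ∀ d : ℝ, 0 < d →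
      disc p αp (fun i : Fin (msize e) => if i.val = 0 then d else 0) = c → d = Δ e)
    (g : ℝ → ℝ → ℝ)
    (hcont : Continuous fun q : ℝ × ℝ => g q.1 q.2)
    -- `g` satisfies the pointwise mean-field rate equation
    (hint1 : ∀ (e : ι) (a t : ℝ), 0 ≤ t →
      Integrable (fun y : Fin (msize e - 1) → ℝ =>
        if disc p αp (Fin.cons ((msize e : ℝ) * a - ∑ j, y j) y) < c
        then g ((msize e : ℝ) * a - ∑ j, y j) t * ∏ j, g (y j) t else 0))
    (hint2 : ∀ (e : ι) (a t : ℝ), 0 ≤ t →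
      Integrable (fun y : Fin (msize e - 1) → ℝ =>
        if disc p αp (Fin.cons a y) < c then ∏ j, g (y j) t else 0))
    (heq : ∀ (a t : ℝ), 0 ≤ t →
      HasDerivAt (fun s => g a s) (mfRHS msize pE p αp c g a t) t)
    -- `g(·,t)` is a probability density for each `t ≥ 0`
    (hdens : ∀ t : ℝ, 0 ≤ t →
      (∀ a, 0 ≤ g a t) ∧ Integrable (fun a => g a t) ∧ (∫ a, g a t) = 1)
    -- `g(·,0)` has bounded support
    (hsupp : ∃ R : ℝ, ∀ a : ℝ, R < |a| → g a 0 = 0)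
    -- weak-form rate equation for convex and for bounded continuous observables
    (hconvex : ∀ φ : ℝ → ℝ, ConvexOn ℝ Set.univ φ → WeakForm msize pE p αp c g φ)
    (hbc : ∀ φ : ℝ → ℝ, Continuous φ → (∃ C, ∀ x, |φ x| ≤ C) →
      WeakForm msize pE p αp c g φ) :
    ∃ (K : ℕ) (a : Fin K → ℝ) (mk : Fin K → ℝ),
      StrictMono a ∧
      (∀ k l : Fin K, (k : ℕ) + 1 = (l : ℕ) →
        (Finset.univ.inf' Finset.univ_nonempty Δ) ≤ a l - a k) ∧
      (∀ k, 0 < mk k) ∧ (∑ k, mk k) = 1 ∧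
      (∀ φ : ℝ → ℝ, Continuous φ → (∃ C, ∀ x, |φ x| ≤ C) →
        Filter.Tendsto (fun t => ∫ x, φ x * g x t) Filter.atTop
          (nhds (∑ k, mk k * φ (a k)))) := by
  obtain ⟨R, hR⟩ := hsupp
  have hcont_t : ∀ t, Continuous fun a => g a t := fun t =>
    hcont.comp (by fun_prop : Continuous fun a : ℝ => (a, t))
  have hanti : ∀ φ : ℝ → ℝ, ConvexOn ℝ Set.univ φ →
      AntitoneOn (fun t => ∫ x, φ x * g x t) (Set.Ici 0) := by
    intro φ hφ
    have hd := (hconvex φ hφ).2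
    refine antitoneOn_of_deriv_nonpos (convex_Ici 0)
      (fun t ht => (hd t ht).continuousAt.continuousWithinAt) ?_ ?_
    · intro t ht
      rw [interior_Ici] at ht
      exact (hd t (le_of_lt ht)).differentiableAt.differentiableWithinAt
    · intro t ht
      rw [interior_Ici] at ht
      rw [(hd t (le_of_lt ht)).deriv]
      refine Finset.sum_nonpos fun e _ => ?_
      refine mul_nonpos_of_nonneg_of_nonpos (mul_nonneg (Nat.cast_nonneg _) (hpE e)) ?_
      exact integral_nonpos fun y =>
        mf_weak_term_nonpos (hm e) (hdens t (le_of_lt ht)).1 hφ y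
  -- support
  have hsupp : ∀ t, 0 ≤ t → ∀ a : ℝ, R < |a| → g a t = 0 := by
    have hφ : ConvexOn ℝ Set.univ (fun x : ℝ => max (|x| - R) 0) := by
      have h1 : ConvexOn ℝ Set.univ (fun x : ℝ => |x| - R) := by
        have h2 : ConvexOn ℝ Set.univ (fun x : ℝ => |x|) := convexOn_univ_norm
        have h3 := h2.add_const (-R)
        refine ⟨convex_univ, fun x _ y _ a b ha hb hab => ?_⟩
        have h4 := h3.2 (Set.mem_univ x) (Set.mem_univ y) ha hb hab
        simpa [sub_eq_add_neg] using h4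
      exact h1.sup (convexOn_const 0 convex_univ)
    intro t ht a ha
    have h0 : ∫ x, max (|x| - R) 0 * g x 0 = 0 := by
      rw [← integral_zero ℝ ℝ]
      congr 1
      ext x
      rcases lt_or_ge R |x| with h | h
      · simp [hR x h]
      · simp [h]
    have h1 := hanti _ hφ (Set.mem_Ici.2 le_rfl) (Set.mem_Ici.2 ht) ht
    simp only [h0] at h1
    have hnn : ∀ x, 0 ≤ max (|x| - R) 0 * g x t := fun x =>
      mul_nonneg (le_max_right _ _) ((hdens t ht).1 x)
    have h2 : ∫ x, max (|x| - R) 0 * g x t = 0 := le_antisymm h1 (integral_nonneg hnn)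
    have h3 := (integral_eq_zero_iff_of_nonneg hnn ((hconvex _ hφ).1 t ht)).1 h2
    have h4 := (Continuous.ae_eq_iff_eq volume
      (by have := hcont_t t; fun_prop) (continuous_const (y := (0 : ℝ)))).1 h3
    have h5 := congrFun h4 a
    rcases mul_eq_zero.1 h5 with h | h
    · rw [max_eq_left (by linarith)] at h
      linarith
    · exact h
  set D := Finset.univ.inf' Finset.univ_nonempty Δ with hDdef
  have hD : 0 < D := (Finset.lt_inf'_iff _).2 fun e _ => hΔpos e
  have hsq : ConvexOn ℝ Set.univ (fun x : ℝ => x ^ 2) := even_two.convexOn_pow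
  obtain ⟨K, a, mk, h1, h2, h3, h4, h5⟩ := mf_abstract g R hcont_t hdens hsupp hanti D hD (by
    intro x y hxy hx hy
    by_contra hlt
    push Not at hlt
    obtain ⟨e, he⟩ : ∃ e, 0 < pE e := by
      by_contra h
      push Not at h
      have := Finset.sum_nonpos fun e (_ : e ∈ Finset.univ) => h e
      linarith
    have hs : 0 < y - x := by linarith
    obtain ⟨δ, hδ, ε, hε, hloc⟩ := mf_local (hm e) hp hc (hΔpos e) (hΔ e) x y hxy
      (lt_of_lt_of_le hlt (Finset.inf'_le _ (Finset.mem_univ e)))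
    obtain ⟨η₁, hη₁, hx⟩ := hx ε hε
    obtain ⟨η₂, hη₂, hy⟩ := hy ε hε
    set η := min η₁ η₂
    have hη : 0 < η := lt_min hη₁ hη₂
    set κ := (msize e : ℝ) * pE e * (δ * η ^ msize e) with hκ
    have hme : 0 < (msize e : ℝ) := by
      have := hm e
      positivity
    have hκ0 : 0 < κ := by positivity
    obtain ⟨N, hN⟩ := eventually_atTop.1 (hx.and hy)
    set T := max N 0
    have hder : ∀ t, T ≤ t → weakRHS msize pE p αp c g (fun x => x ^ 2) t ≤ -κ := by
      intro t ht
      have ht0 : 0 ≤ t := (le_max_right _ _).trans ht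
      obtain ⟨hxt, hyt⟩ := hN t ((le_max_left _ _).trans ht)
      have hterm := mf_dissipation (hm e) hp (hcont_t t) (hdens t ht0) (hsupp t ht0) hε hδ.le hloc hη.le
        ((min_le_left _ _).trans hxt) ((min_le_right _ _).trans hyt)
      unfold weakRHS
      classical
      rw [← Finset.add_sum_erase _ _ (Finset.mem_univ e)]
      have hrest : ∑ e' ∈ Finset.univ.erase e, (msize e' : ℝ) * pE e' *
          ∫ y : Fin (msize e') → ℝ, (if disc p αp y < c then (∏ i, g (y i) t) *
          (((1 / (msize e' : ℝ)) * ∑ i, y i) ^ 2 - (1 / (msize e' : ℝ)) * ∑ i, (y i) ^ 2)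
          else 0) ≤ 0 := by
        refine Finset.sum_nonpos fun e' _ => ?_
        refine mul_nonpos_of_nonneg_of_nonpos (mul_nonneg (Nat.cast_nonneg _) (hpE e')) ?_
        exact integral_nonpos fun y => mf_weak_term_nonpos (hm e') (hdens t ht0).1 hsq y
      have := mul_le_mul_of_nonneg_left hterm (mul_pos hme he).le
      rw [hκ]
      linarith
    have hd := (hconvex _ hsq).2
    set J := fun s => ∫ a, a ^ 2 * g a s with hJ
    have hJ0 : ∀ t, 0 ≤ t → 0 ≤ J t := fun t ht =>
      integral_nonneg fun z => mul_nonneg (sq_nonneg z) ((hdens t ht).1 z)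
    have hT0 : 0 ≤ T := le_max_right _ _
    have hA : AntitoneOn (fun t => J t + κ * t) (Set.Ici T) := by
      have hd' : ∀ t, T ≤ t → HasDerivAt (fun t => J t + κ * t)
          (weakRHS msize pE p αp c g (fun x => x ^ 2) t + κ) t := by
        intro t ht
        have h := (hd t (hT0.trans ht)).add ((hasDerivAt_id t).const_mul κ)
        rw [mul_one] at h
        exact h
      refine antitoneOn_of_deriv_nonpos (convex_Ici T)
        (fun t ht => (hd' t ht).continuousAt.continuousWithinAt) ?_ ?_
      · intro t ht
        rw [interior_Ici] at ht
        exact (hd' t (le_of_lt ht)).differentiableAt.differentiableWithinAt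
      · intro t ht
        rw [interior_Ici] at ht
        rw [(hd' t (le_of_lt ht)).deriv]
        linarith [hder t (le_of_lt ht)]
    have hq : 0 < (J T + 1) / κ := div_pos (by linarith [hJ0 T hT0]) hκ0
    have hle : T ≤ T + (J T + 1) / κ := by linarith
    have h6 := hA (Set.mem_Ici.2 le_rfl) (Set.mem_Ici.2 hle) hle
    have h7 := hJ0 _ (hT0.trans hle)
    have h8 : κ * ((J T + 1) / κ) = J T + 1 := by field_simp
    simp only [mul_add, h8] at h6
    linarith)
  exact ⟨K, a, mk, h1, fun k l hkl => h2 k l (by rw [Fin.lt_def]; omega), h3, h4,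
    fun φ hφ _ => h5 φ hφ⟩
end
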